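/- arXiv:1502.02314 — 5 statements merged into one kernel-verified Lean document; each statement's English description precedes it below -/
import Mathlib

section
/- Let G be a finite group, H ≤ G a subgroup, d ∈ G, S = H ∩ dHd⁻¹, and m a positive integer. The element Σ_{h ∈ H, (dh)^m ∈ S} [(dh)^m] of the group algebra ℂ[S] (the sum, over all h ∈ H such that (dh)^m ∈ S, of the basis element corresponding to (dh)^m viewed as an element of S) lies in the center of ℂ[S]. -/
/-- An element of a monoid algebra over a commutative semiring that commutes with every
`MonoidAlgebra.single s 1` is central. -/
theorem MonoidAlgebra.mem_center_of_commute_single {R M : Type*} [CommSemiring R] [Monoid M]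
    {a : MonoidAlgebra R M} (ha : ∀ s : M, single s 1 * a = a * single s 1) :
    a ∈ Subalgebra.center R (MonoidAlgebra R M) := by
  rw [Subalgebra.mem_center_iff]
  intro b
  induction b using MonoidAlgebra.induction_on with
  | of s => exact ha s
  | add x y hx hy => rw [add_mul, mul_add, hx, hy]
  | smul r x hx => rw [smul_mul_assoc, mul_smul_comm, hx]

open scoped Classical in
/-- With `S = H ∩ dHd⁻¹` and `m ≥ 1`, the element
`Σ_{h ∈ H, (dh)^m ∈ S} [(dh)^m]` of the group algebra `ℂ[S]` is central. -/
theorem stmt6 (G : Type*) [Group G] [Fintype G] (H : Subgroup G) (d : G)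
    (S : Subgroup G) (hS : ∀ x : G, x ∈ S ↔ x ∈ H ∧ d⁻¹ * x * d ∈ H)
    (m : ℕ) (hm : 0 < m) :
    (∑ h : G, if hc : h ∈ H ∧ (d * h) ^ m ∈ S then
        MonoidAlgebra.single (⟨(d * h) ^ m, hc.2⟩ : S) (1 : ℂ) else 0)
      ∈ Subalgebra.center ℂ (MonoidAlgebra ℂ S) := by
  refine MonoidAlgebra.mem_center_of_commute_single fun s => ?_
  obtain ⟨hsH, hsd⟩ := (hS s).1 s.2
  rw [Finset.mul_sum, Finset.sum_mul]
  refine Fintype.sum_equiv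
    ((Equiv.mulLeft (d⁻¹ * s * d)).trans (Equiv.mulRight (s : G)⁻¹)) _ _ fun h => ?_
  generalize hk : ((Equiv.mulLeft (d⁻¹ * s * d)).trans (Equiv.mulRight (s : G)⁻¹)) h = k
  replace hk : k = d⁻¹ * s * d * h * (s : G)⁻¹ := hk.symm
  have hpow : (d * k) ^ m = s * (d * h) ^ m * (s : G)⁻¹ := by
    rw [← conj_pow, hk]
    congr 1
    group
  have hiff : (k ∈ H ∧ (d * k) ^ m ∈ S) ↔ h ∈ H ∧ (d * h) ^ m ∈ S := by
    rw [hpow, hk, H.mul_mem_cancel_right (H.inv_mem hsH), H.mul_mem_cancel_left hsd,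
      S.mul_mem_cancel_right (S.inv_mem s.2), S.mul_mem_cancel_left s.2]
  by_cases hc : h ∈ H ∧ (d * h) ^ m ∈ S
  · rw [dif_pos hc, dif_pos (hiff.2 hc), MonoidAlgebra.single_mul_single,
      MonoidAlgebra.single_mul_single]
    congr 1
    ext
    simp [hpow]
  · rw [dif_neg hc, dif_neg (mt hiff.1 hc), mul_zero, zero_mul]
end

section
/- Let G be a finite group, H ≤ G a subgroup, d ∈ G, S = H ∩ dHd⁻¹, and m a positive integer. The function ζ_m : S → ℕ defined by ζ_m(y) = |{h ∈ H | (dh)^m = y}| is a class function on S; that is, ζ_m(sys⁻¹) = ζ_m(y) for all s, y ∈ S. -/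
/-- With `S = H ∩ dHd⁻¹` and `m ≥ 1`, the function
`ζ_m(y) = |{h ∈ H | (dh)^m = y}|` is a class function on `S`. -/
theorem stmt7 (G : Type*) [Group G] [Finite G] (H : Subgroup G) (d : G)
    (S : Subgroup G) (hS : ∀ x : G, x ∈ S ↔ x ∈ H ∧ d⁻¹ * x * d ∈ H)
    (m : ℕ) (hm : 0 < m)
    (s y : G) (hs : s ∈ S) (hy : y ∈ S) :
    Nat.card {h : G | h ∈ H ∧ (d * h) ^ m = s * y * s⁻¹}
      = Nat.card {h : G | h ∈ H ∧ (d * h) ^ m = y} := by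
  obtain ⟨hsH, hdsH⟩ := (hS s).1 hs
  let e : G ≃ G := (Equiv.mulLeft (d⁻¹ * s * d)).trans (Equiv.mulRight s⁻¹)
  have he (h : G) : e h = d⁻¹ * s * d * h * s⁻¹ := rfl
  refine (Nat.card_congr (e.subtypeEquiv fun h => ?_)).symm
  have hconj : d * e h = s * (d * h) * s⁻¹ := by rw [he]; group
  have hmem : e h ∈ H ↔ h ∈ H := by
    rw [he, H.mul_mem_cancel_right (H.inv_mem hsH), H.mul_mem_cancel_left hdsH]
  simp only [Set.mem_ofPred_eq, hmem, hconj, conj_pow, mul_left_inj, mul_right_inj]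
end

section
/- Let G be a finite group, H ≤ G a subgroup, d ∈ G, S = H ∩ dHd⁻¹, and m a positive integer. Let (V_i)_{i ∈ I} be a finite family of irreducible finite-dimensional complex representations of S that are pairwise non-isomorphic and such that every irreducible finite-dimensional complex representation of S is isomorphic to some V_i; let χ_i denote the character of V_i. Then for every y ∈ S: Σ_{i ∈ I} [ (1/|S|)·Σ_{h ∈ H, (dh)^m ∈ S} conj(χ_i((dh)^m)) ]·χ_i(y) = |{h ∈ H | (dh)^m = y}|. -/
open scoped Matrix ComplexOrder in
/-- The form `∑ g, ρ(g)ᴴ ρ(g)` is positive definite and invariant, so `ρ(g)ᴴ` is conjugate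
to `ρ(g⁻¹)`. -/
theorem Matrix.trace_monoidHom_inv {G n : Type*} [Group G] [Fintype G] [Fintype n] [DecidableEq n]
    (ρ : G →* Matrix n n ℂ) (g : G) : (ρ g⁻¹).trace = starRingEnd ℂ (ρ g).trace := by
  let P : Matrix n n ℂ := ∑ s, (ρ s)ᴴ * ρ s
  have hP : P.PosDef := by
    refine Matrix.posDef_sum Finset.univ_nonempty fun s _ ↦ ?_
    refine Matrix.PosDef.conjTranspose_mul_self _ (Matrix.mulVec_injective_of_isUnit ?_)
    exact (Group.isUnit s).map ρ
  have hinv : (ρ g)ᴴ * P * ρ g = P := by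
    simp only [P, Finset.mul_sum, Finset.sum_mul]
    rw [← Equiv.sum_comp (Equiv.mulRight g) fun s ↦ (ρ s)ᴴ * ρ s]
    simp [Matrix.mul_assoc]
  have hcomm : (ρ g)ᴴ * P = P * ρ g⁻¹ := by
    rw [← hinv, Matrix.mul_assoc _ (ρ g), ← map_mul, mul_inv_cancel, map_one, mul_one, hinv]
  have hdet : IsUnit P.det := (Matrix.isUnit_iff_isUnit_det _).mp hP.isUnit
  calc (ρ g⁻¹).trace = (P⁻¹ * (P * ρ g⁻¹)).trace := by
        rw [Matrix.nonsing_inv_mul_cancel_left _ _ hdet]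
    _ = (ρ g)ᴴ.trace := by
        rw [← hcomm, Matrix.trace_mul_comm, Matrix.mul_nonsing_inv_cancel_right _ _ hdet]
    _ = starRingEnd ℂ (ρ g).trace := Matrix.trace_conjTranspose _

namespace Representation

variable {G : Type*} [Group G] [Fintype G]

theorem char_inv_eq_conj {V : Type*} [AddCommGroup V] [Module ℂ V] [FiniteDimensional ℂ V]
    (ρ : Representation ℂ G V) (g : G) : ρ.character g⁻¹ = starRingEnd ℂ (ρ.character g) := by
  let b := Module.finBasis ℂ V
  have h := Matrix.trace_monoidHom_inv
    ((LinearMap.toMatrixAlgEquiv b).toMulEquiv.toMonoidHom.comp ρ) g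
  simpa [character, LinearMap.trace_eq_matrix_trace ℂ b, LinearMap.toMatrixAlgEquiv] using h

/-- If a class function is orthogonal to the character of an irreducible representation, then
the corresponding central element of the group algebra acts as zero. -/
theorem IsIrreducible.sum_smul_eq_zero {V : Type*} [AddCommGroup V] [Module ℂ V]
    [FiniteDimensional ℂ V] (ρ : Representation ℂ G V) [IsIrreducible ρ] {f : G → ℂ}
    (hf : ∀ s x, f (s * x * s⁻¹) = f x) (h : ∑ s, f s * ρ.character s = 0) :
    ∑ s, f s • ρ s = 0 := by
  have hcomm (g : G) : (∑ s, f s • ρ s) ∘ₗ ρ g = ρ g ∘ₗ ∑ s, f s • ρ s := by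
    change (∑ s, f s • ρ s) * ρ g = ρ g * ∑ s, f s • ρ s
    rw [Finset.sum_mul, Finset.mul_sum, ← Equiv.sum_comp (MulAut.conj g).toEquiv]
    simp [hf, ← map_mul]
  let T : IntertwiningMap ρ ρ := ⟨∑ s, f s • ρ s, hcomm⟩
  obtain ⟨c, hc⟩ := algebraMap_intertwiningMap_bijective_of_isAlgClosed.2 T
  have hT : ∑ s, f s • ρ s = c • LinearMap.id :=
    (congrArg IntertwiningMap.toLinearMap hc).symm
  have : Nontrivial V := by
    by_contra hV
    rw [not_nontrivial_iff_subsingleton] at hV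
    have h1 := finrank_intertwiningMap_self ρ
    have : Subsingleton (IntertwiningMap ρ ρ) :=
      ⟨fun a b ↦ IntertwiningMap.ext (LinearMap.ext fun v ↦ Subsingleton.elim _ _)⟩
    simp [Module.finrank_zero_of_subsingleton] at h1
  have htr : c * (Module.finrank ℂ V : ℂ) = 0 := by
    have := congrArg (LinearMap.trace ℂ V) hT
    rw [map_smul, LinearMap.trace_id, smul_eq_mul] at this
    rw [← this, ← h]
    simp [character]
  have hc0 : c = 0 := (mul_eq_zero.mp htr).resolve_right (by exact_mod_cast Module.finrank_pos.ne')
  rw [hT, hc0, zero_smul]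

end Representation

open scoped MonoidAlgebra in
theorem MonoidAlgebra.sum_single_smul_eq_zero {G : Type} [Group G] [Fintype G] {f : G → ℂ}
    (hf : ∀ s x, f (s * x * s⁻¹) = f x)
    (h : ∀ (W : FDRep ℂ G), CategoryTheory.Simple W → ∑ s, f s * W.character s = 0)
    (M : Type) [AddCommGroup M] [Module ℂ M] [Module ℂ[G] M] [IsScalarTower ℂ ℂ[G] M]
    [IsSimpleModule ℂ[G] M] (x : M) :
    (∑ s, MonoidAlgebra.single s (f s) : ℂ[G]) • x = 0 := by
  let ρ : Representation ℂ G M := Representation.ofModule' M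
  have hρ : ρ.asAlgebraHom = Algebra.lsmul ℂ ℂ M :=
    (MonoidAlgebra.lift ℂ (M →ₗ[ℂ] M) G).apply_symm_apply _
  let e : ρ.asModule ≃ₗ[ℂ[G]] M :=
    { ρ.asModuleEquiv with
      map_smul' := fun r v ↦ by
        change ρ.asModuleEquiv (r • v) = r • ρ.asModuleEquiv v
        rw [Representation.asModuleEquiv_map_smul, hρ, Algebra.lsmul_coe] }
  have : ρ.IsIrreducible :=
    ρ.irreducible_iff_isSimpleModule_asModule.mpr (IsSimpleModule.congr e)
  have : FiniteDimensional ℂ M := Module.Finite.trans ℂ[G] M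
  have hsimple : CategoryTheory.Simple (FDRep.of ρ) := by
    have : Invertible (Nat.card G : ℂ) := invertibleOfNonzero (by simp)
    rw [FDRep.simple_iff_char_is_norm_one]
    have := Representation.char_orthonormal ρ ρ
    rw [if_pos ⟨Representation.Equiv.refl ρ⟩, inv_mul_eq_one₀ (by simp)] at this
    exact this.symm
  have h0 := Representation.IsIrreducible.sum_smul_eq_zero ρ hf (h (FDRep.of ρ) hsimple)
  have hz : ρ.asAlgebraHom (∑ s, MonoidAlgebra.single s (f s)) = 0 := by
    rw [map_sum, ← h0]
    exact Finset.sum_congr rfl fun s _ ↦ ρ.asAlgebraHom_single s (f s)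
  rw [hρ] at hz
  exact LinearMap.congr_fun hz x

open scoped MonoidAlgebra in
/-- A class function orthogonal to all irreducible characters vanishes. -/
theorem classFunction_eq_zero {G : Type} [Group G] [Fintype G] {f : G → ℂ}
    (hf : ∀ s x, f (s * x * s⁻¹) = f x)
    (h : ∀ (W : FDRep ℂ G), CategoryTheory.Simple W → ∑ s, f s * W.character s = 0) :
    f = 0 := by
  let z : ℂ[G] := ∑ s, MonoidAlgebra.single s (f s)
  have hz : z ∈ Ring.jacobson ℂ[G] := by
    refine (Submodule.mem_sInf).mpr fun J hJ ↦ ?_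
    have : IsSimpleModule ℂ[G] (ℂ[G] ⧸ J) := isSimpleModule_iff_isCoatom.mpr hJ
    have h1 := MonoidAlgebra.sum_single_smul_eq_zero hf h (ℂ[G] ⧸ J) (Submodule.Quotient.mk 1)
    rwa [← Submodule.Quotient.mk_smul, Submodule.Quotient.mk_eq_zero, smul_eq_mul, mul_one] at h1
  rw [IsSemisimpleRing.jacobson_eq_bot, Submodule.mem_bot] at hz
  ext g
  have := congrArg (fun a : ℂ[G] ↦ a.coeff g) hz
  classical
  simpa [z, Finsupp.single_apply, Finsupp.finsetSum_apply] using this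

open CategoryTheory in
/-- Expansion of a class function in irreducible characters. -/
theorem classFunction_eq_sum_character {G : Type} [Group G] [Fintype G] {I : Type*} [Fintype I]
    (V : I → FDRep ℂ G) (hsimple : ∀ i, Simple (V i))
    (hdistinct : ∀ i j, i ≠ j → ¬ Nonempty (V i ≅ V j))
    (hall : ∀ W : FDRep ℂ G, Simple W → ∃ i, Nonempty (W ≅ V i))
    {f : G → ℂ} (hf : ∀ s x, f (s * x * s⁻¹) = f x) (y : G) :
    ∑ i, (1 / (Nat.card G : ℂ) * ∑ x, f x * starRingEnd ℂ ((V i).character x)) *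
      (V i).character y = f y := by
  classical
  have : Invertible (Nat.card G : ℂ) := invertibleOfNonzero (by simp)
  let c (i : I) : ℂ := 1 / (Nat.card G : ℂ) * ∑ x, f x * starRingEnd ℂ ((V i).character x)
  let F (x : G) : ℂ := ∑ i, c i * (V i).character x - f x
  have hconj (i : I) (x : G) : (V i).character x⁻¹ = starRingEnd ℂ ((V i).character x) :=
    Representation.char_inv_eq_conj (V i).ρ x
  have horth (i j : I) : ∑ x, (V i).character x * (V j).character x⁻¹ =
      if i = j then (Nat.card G : ℂ) else 0 := by
    have := FDRep.char_orthonormal (V i) (V j)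
    rw [inv_mul_eq_iff_eq_mul₀ (by simp)] at this
    rw [this]
    by_cases hij : i = j
    · subst hij
      simp [show Nonempty (V i ≅ V i) from ⟨Iso.refl _⟩]
    · simp [hij, hdistinct i j hij]
  have hF : (fun x ↦ F x⁻¹) = 0 := by
    refine classFunction_eq_zero (fun s x ↦ ?_) fun W hW ↦ ?_
    · have : (s * x * s⁻¹)⁻¹ = s * x⁻¹ * s⁻¹ := by group
      simp [F, this, hf, FDRep.char_conj]
    · obtain ⟨j, ⟨e⟩⟩ := hall W hW
      rw [FDRep.char_iso e, ← Equiv.sum_comp (Equiv.inv G)]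
      simp only [Equiv.inv_apply, inv_inv, F, sub_mul, Finset.sum_mul, Finset.sum_sub_distrib]
      rw [Finset.sum_comm]
      simp only [mul_assoc, ← Finset.mul_sum, horth]
      simp only [mul_ite, mul_zero, Finset.sum_ite_eq', Finset.mem_univ, if_true, hconj]
      simp only [c]
      field_simp
      simp
  have hFy := congrFun hF y⁻¹
  simpa only [F, inv_inv, Pi.zero_apply, sub_eq_zero] using hFy

open CategoryTheory in
open scoped Classical in
/-- With `S = H ∩ dHd⁻¹`, `m ≥ 1`, and `(V i)_{i ∈ I}` a complete family of
pairwise non-isomorphic irreducible complex representations of `S` with characters `χ i`,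
for every `y ∈ S`:
`Σ_i [(1/|S|)·Σ_{h ∈ H, (dh)^m ∈ S} conj(χ i ((dh)^m))]·(χ i y) = |{h ∈ H | (dh)^m = y}|`. -/
theorem stmt8 (G : Type) [Group G] [Fintype G] (H : Subgroup G) (d : G)
    (S : Subgroup G) (hS : ∀ x : G, x ∈ S ↔ x ∈ H ∧ d⁻¹ * x * d ∈ H)
    (m : ℕ) (hm : 0 < m)
    (I : Type) [Fintype I] (V : I → FDRep ℂ S)
    (hsimple : ∀ i, Simple (V i))
    (hdistinct : ∀ i j, i ≠ j → ¬ Nonempty (V i ≅ V j))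
    (hall : ∀ W : FDRep ℂ S, Simple W → ∃ i, Nonempty (W ≅ V i))
    (y : G) (hy : y ∈ S) :
    ∑ i : I,
        ((1 / (Nat.card S : ℂ)) *
          ∑ h : G, if hc : h ∈ H ∧ (d * h) ^ m ∈ S then
            (starRingEnd ℂ) ((V i).character ⟨(d * h) ^ m, hc.2⟩) else 0) *
          (V i).character ⟨y, hy⟩
      = (Nat.card {h : G | h ∈ H ∧ (d * h) ^ m = y} : ℂ) := by
  let f (x : S) : ℂ := Nat.card {h : G | h ∈ H ∧ (d * h) ^ m = x}
  have hf (s x : S) : f (s * x * s⁻¹) = f x := by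
    obtain ⟨hs, hsd⟩ := (hS s).mp s.2
    have hpow (h : G) : (d * (d⁻¹ * s * d * h * (s : G)⁻¹)) ^ m = s * (d * h) ^ m * (s : G)⁻¹ := by
      rw [← conj_pow]
      group
    let e : G ≃ G := (Equiv.mulLeft (d⁻¹ * s * d)).trans (Equiv.mulRight (s : G)⁻¹)
    refine congrArg Nat.cast (Nat.card_congr (e.subtypeEquiv fun h ↦ ?_)).symm
    change h ∈ H ∧ (d * h) ^ m = x ↔
      d⁻¹ * s * d * h * (s : G)⁻¹ ∈ H ∧ (d * (d⁻¹ * s * d * h * (s : G)⁻¹)) ^ m = s * x * (s : G)⁻¹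
    rw [hpow, H.mul_mem_cancel_right (H.inv_mem hs), H.mul_mem_cancel_left hsd, mul_left_inj,
      mul_right_inj]
  change _ = f ⟨y, hy⟩
  rw [← classFunction_eq_sum_character V hsimple hdistinct hall hf]
  refine Finset.sum_congr rfl fun i _ ↦ ?_
  congr 2
  have hfx (x : S) : f x = ∑ h : G, if h ∈ H ∧ (d * h) ^ m = x then 1 else 0 := by
    simp [f, Nat.card_eq_fintype_card, Fintype.card_subtype]
  simp only [hfx, Finset.sum_mul]
  rw [Finset.sum_comm]
  refine Finset.sum_congr rfl fun h _ ↦ ?_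
  split_ifs with hc
  · rw [Finset.sum_eq_single ⟨(d * h) ^ m, hc.2⟩]
    · simp [hc.1]
    · intro x _ hx
      rw [if_neg (fun hh ↦ hx (Subtype.ext hh.2.symm)), zero_mul]
    · simp
  · refine (Finset.sum_eq_zero fun x _ ↦ ?_).symm
    rw [if_neg (fun hh : h ∈ H ∧ (d * h) ^ m = x ↦ hc ⟨hh.1, hh.2 ▸ x.2⟩), zero_mul]
end

section
/- Let G be a finite group, H ≤ G a subgroup, d ∈ G, S = H ∩ dHd⁻¹, and E = C_G(d) ∩ (S·C_G(S)) ∩ N_G(H). Then for every s ∈ S·E and every h ∈ H, the element (d⁻¹sd)·h·s⁻¹ lies in H; the map (s, h) ↦ (d⁻¹sd)·h·s⁻¹ defines a group action of the subgroup S·E on the set H (i.e. 1 acts as the identity and s·(t·h) = (st)·h); and this action satisfies d·((d⁻¹sd)·h·s⁻¹) = s·(dh)·s⁻¹ for all s ∈ S·E and h ∈ H. -/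
open scoped Pointwise in
/-- With `S = H ∩ dHd⁻¹` and `E = C_G(d) ∩ (S·C_G(S)) ∩ N_G(H)`, for every
`s` in the subgroup `S·E` and every `h ∈ H` the element `(d⁻¹sd)·h·s⁻¹` lies in `H`; the
map `(s, h) ↦ (d⁻¹sd)·h·s⁻¹` is a group action of `S·E` on `H` (`1` acts as the identity
and `s·(t·h) = (st)·h`); and `d·((d⁻¹sd)·h·s⁻¹) = s·(dh)·s⁻¹`. -/
theorem stmt13 (G : Type*) [Group G] [Finite G] (H : Subgroup G) (d : G)
    (S : Subgroup G) (hS : ∀ x : G, x ∈ S ↔ x ∈ H ∧ d⁻¹ * x * d ∈ H)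
    (E : Set G)
    (hE : E = ((Subgroup.centralizer {d} : Subgroup G) : Set G) ∩
        ((S : Set G) * ((Subgroup.centralizer (S : Set G) : Subgroup G) : Set G)) ∩
        ((Subgroup.normalizer H : Subgroup G) : Set G)) :
    (∀ s ∈ (S : Set G) * E, ∀ h ∈ H, (d⁻¹ * s * d) * h * s⁻¹ ∈ H) ∧
    (∀ h ∈ H, (d⁻¹ * 1 * d) * h * (1 : G)⁻¹ = h) ∧
    (∀ s ∈ (S : Set G) * E, ∀ t ∈ (S : Set G) * E, ∀ h ∈ H,
      (d⁻¹ * s * d) * ((d⁻¹ * t * d) * h * t⁻¹) * s⁻¹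
        = (d⁻¹ * (s * t) * d) * h * (s * t)⁻¹) ∧
    (∀ s ∈ (S : Set G) * E, ∀ h ∈ H, d * ((d⁻¹ * s * d) * h * s⁻¹) = s * (d * h) * s⁻¹) := by
  subst hE
  refine ⟨?_, fun h _ => by group, fun s _ t _ h _ => by group, fun s _ h _ => by group⟩
  rintro _ ⟨s, hs, e, ⟨⟨hed, -⟩, heH⟩, rfl⟩ h hh
  have hcomm : d * e = e * d := Subgroup.mem_centralizer_iff.mp hed d rfl
  have hconj : e * h * e⁻¹ ∈ H := (Subgroup.mem_normalizer_iff.mp heH h).mp hh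
  obtain ⟨hsH, hsd⟩ := (hS s).mp hs
  have key : d⁻¹ * (s * e) * d * h * (s * e)⁻¹ = d⁻¹ * s * d * (e * h * e⁻¹) * s⁻¹ := by
    calc d⁻¹ * (s * e) * d * h * (s * e)⁻¹
        = d⁻¹ * s * (e * d) * h * e⁻¹ * s⁻¹ := by group
      _ = d⁻¹ * s * (d * e) * h * e⁻¹ * s⁻¹ := by rw [hcomm]
      _ = d⁻¹ * s * d * (e * h * e⁻¹) * s⁻¹ := by group
  change d⁻¹ * (s * e) * d * h * (s * e)⁻¹ ∈ H
  rw [key]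
  exact H.mul_mem (H.mul_mem hsd hconj) (H.inv_mem hsH)
end

section
/- Let G be a finite group, H ≤ G a subgroup, d ∈ G, S = H ∩ dHd⁻¹, m a positive integer, and E = C_G(d) ∩ (S·C_G(S)) ∩ N_G(H). Let S' be a subgroup of G contained in the subgroup S·E. Then conjugation by elements of S' preserves the coset dH, and for every class function η : S → ℂ and every set R' ⊆ dH containing exactly one element from each orbit of the conjugation action of S' on dH, one has (1/|S|)·Σ_{h ∈ H, (dh)^m ∈ S} η((dh)^m) = (1/|S|)·Σ_{r ∈ R', r^m ∈ S} (|S'|/|S' ∩ C_G(r)|)·η(r^m). -/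
/-- Orbit-stabilizer for the conjugation action of a subgroup on the ambient group. -/
theorem Subgroup.card_conj_orbit_mul_card_centralizer {G : Type*} [Group G] [Finite G]
    (K : Subgroup G) (r : G) :
    Nat.card {x : G | ∃ s ∈ K, s * x * s⁻¹ = r} * Nat.card {c : G | c ∈ K ∧ c * r = r * c} =
      Nat.card K := by
  let _ : MulAction K G := MulAction.compHom G (MulAut.conj.comp K.subtype)
  have smul_def (s : K) (x : G) : s • x = s * x * (s : G)⁻¹ := rfl
  have horbit : {x : G | ∃ s ∈ K, s * x * s⁻¹ = r} = MulAction.orbit K r := by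
    ext x
    rw [MulAction.mem_orbit_symm, MulAction.mem_orbit_iff]
    simp [smul_def]
  have hstab : Nat.card {c : G | c ∈ K ∧ c * r = r * c} =
      Nat.card (MulAction.stabilizer K r) := by
    refine Nat.card_congr
      ⟨fun c => ⟨⟨c, c.2.1⟩, ?_⟩, fun c => ⟨c, c.1.2, ?_⟩, fun _ => rfl, fun _ => rfl⟩
    · rw [MulAction.mem_stabilizer_iff, smul_def, mul_inv_eq_iff_eq_mul]
      exact c.2.2
    · have hc := c.2
      rwa [MulAction.mem_stabilizer_iff, smul_def, mul_inv_eq_iff_eq_mul] at hc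
  rw [horbit, hstab, ← Nat.card_prod]
  exact Nat.card_congr (MulAction.orbitProdStabilizerEquivGroup K r)

open scoped Classical in
/-- The sum of a conjugation-invariant function over an invariant set, computed on a set of
orbit representatives. -/
theorem Subgroup.sum_eq_sum_conj_representatives {G : Type*} [Group G] [Fintype G]
    (K : Subgroup G) (X R : Finset G) (hX : ∀ s ∈ K, ∀ x ∈ X, s * x * s⁻¹ ∈ X) (hRX : R ⊆ X)
    (hR : ∀ x ∈ X, ∃! r : G, r ∈ R ∧ ∃ s ∈ K, s * x * s⁻¹ = r)
    (f : G → ℂ) (hf : ∀ s ∈ K, ∀ x ∈ X, f (s * x * s⁻¹) = f x) :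
    ∑ x ∈ X, f x =
      ∑ r ∈ R, ((Nat.card K : ℂ) / (Nat.card {c : G | c ∈ K ∧ c * r = r * c} : ℂ)) * f r := by
  choose! ρ hρ hρ_unique using hR
  rw [← Finset.sum_fiberwise_of_maps_to (fun x hx => (hρ x hx).1)]
  refine Finset.sum_congr rfl fun r hr => ?_
  have hfiber (x : G) : x ∈ X.filter (ρ · = r) ↔ ∃ s ∈ K, s * x * s⁻¹ = r := by
    rw [Finset.mem_filter]
    constructor
    · rintro ⟨hx, rfl⟩
      exact (hρ x hx).2
    · rintro ⟨s, hs, hsx⟩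
      have hx : x ∈ X := by
        have := hX s⁻¹ (inv_mem hs) r (hRX hr)
        rw [← hsx] at this
        simpa [mul_assoc] using this
      exact ⟨hx, (hρ_unique x hx r ⟨hr, s, hs, hsx⟩).symm⟩
  have hconst : ∀ x ∈ X.filter (ρ · = r), f x = f r := fun x hx => by
    obtain ⟨s, hs, hsx⟩ := (hfiber x).1 hx
    rw [← hsx, hf s hs x (Finset.mem_filter.1 hx).1]
  have hcard : Nat.card {x : G | ∃ s ∈ K, s * x * s⁻¹ = r} = (X.filter (ρ · = r)).card := by
    rw [← Nat.card_eq_finsetCard]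
    exact Nat.card_congr (Equiv.subtypeEquivRight fun x => (hfiber x).symm)
  have hC : (Nat.card {c : G | c ∈ K ∧ c * r = r * c} : ℂ) ≠ 0 := by
    have : Nonempty {c : G | c ∈ K ∧ c * r = r * c} := ⟨1, one_mem K, by simp⟩
    exact_mod_cast Nat.card_pos.ne'
  rw [Finset.sum_congr rfl hconst, Finset.sum_const, nsmul_eq_mul, ← hcard,
    ← K.card_conj_orbit_mul_card_centralizer r, Nat.cast_mul, mul_div_cancel_right₀ _ hC]

open scoped Classical Pointwise in
/-- With `S = H ∩ dHd⁻¹`, `E = C_G(d) ∩ (S·C_G(S)) ∩ N_G(H)`, and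
`S' ≤ S·E` a subgroup: conjugation by elements of `S'` preserves `dH`, and for every
class function `η` on `S` and every set `R'` of representatives of the orbits of the
conjugation action of `S'` on `dH`:
`(1/|S|)·Σ_{h ∈ H, (dh)^m ∈ S} η((dh)^m)
  = (1/|S|)·Σ_{r ∈ R', r^m ∈ S} (|S'|/|S' ∩ C_G(r)|)·η(r^m)`. -/
theorem stmt14 (G : Type*) [Group G] [Fintype G] (H : Subgroup G) (d : G)
    (S : Subgroup G) (hS : ∀ x : G, x ∈ S ↔ x ∈ H ∧ d⁻¹ * x * d ∈ H)
    (m : ℕ) (hm : 0 < m)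
    (E : Set G)
    (hE : E = ((Subgroup.centralizer {d} : Subgroup G) : Set G) ∩
        ((S : Set G) * ((Subgroup.centralizer (S : Set G) : Subgroup G) : Set G)) ∩
        ((Subgroup.normalizer H : Subgroup G) : Set G))
    (S' : Subgroup G) (hS' : (S' : Set G) ⊆ (S : Set G) * E)
    (η : G → ℂ) (hη : ∀ s ∈ S, ∀ t ∈ S, η (s * t * s⁻¹) = η t)
    (R' : Finset G) (hR'sub : ∀ r ∈ R', ∃ h ∈ H, r = d * h)
    (hR'rep : ∀ x : G, (∃ h ∈ H, x = d * h) →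
      ∃! r : G, r ∈ R' ∧ ∃ s ∈ S', s * x * s⁻¹ = r) :
    (∀ s ∈ S', ∀ r : G, (∃ h ∈ H, r = d * h) → ∃ h ∈ H, s * r * s⁻¹ = d * h) ∧
    (1 / (Nat.card S : ℂ)) *
        ∑ h ∈ Finset.univ.filter (fun h : G => h ∈ H ∧ (d * h) ^ m ∈ S), η ((d * h) ^ m)
      = (1 / (Nat.card S : ℂ)) *
          ∑ r ∈ R'.filter (fun r => r ^ m ∈ S),
            ((Nat.card S' : ℂ) / (Nat.card {c : G | c ∈ S' ∧ c * r = r * c} : ℂ)) *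
              η (r ^ m) := by
  have hconj : ∀ s ∈ S', ∀ r : G, (∃ h ∈ H, r = d * h) → ∃ h ∈ H, s * r * s⁻¹ = d * h := by
    rintro s hs _ ⟨h, hh, rfl⟩
    obtain ⟨t, ht, e, he, rfl⟩ := hS' hs
    rw [hE] at he
    obtain ⟨⟨hed, -⟩, heH⟩ := he
    have hed : d * e = e * d := Subgroup.mem_centralizer_singleton_iff.1 hed |>.symm
    obtain ⟨htH, htd⟩ := (hS t).1 ht
    have heh : e * h * e⁻¹ ∈ H := (Subgroup.mem_normalizer_iff.1 heH h).1 hh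
    refine ⟨d⁻¹ * t * d * (e * h * e⁻¹) * t⁻¹,
      mul_mem (mul_mem htd heh) (inv_mem htH), ?_⟩
    simp only [mul_inv_rev, mul_assoc, mul_inv_cancel_left]
    rw [← mul_assoc e d, ← hed, mul_assoc]
  have hinner : ∀ s ∈ S', ∃ u ∈ S, ∀ t ∈ S, s * t * s⁻¹ = u * t * u⁻¹ := by
    intro s hs
    obtain ⟨v, hv, e, he, rfl⟩ := hS' hs
    rw [hE] at he
    obtain ⟨⟨-, w, hw, c, hc, rfl⟩, -⟩ := he
    refine ⟨v * w, mul_mem hv hw, fun t ht => ?_⟩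
    have hct : t * c = c * t := Subgroup.mem_centralizer_iff.1 hc t ht
    have hct' : c * t * c⁻¹ = t := by rw [← hct, mul_inv_cancel_right]
    calc v * (w * c) * t * (v * (w * c))⁻¹ = v * w * (c * t * c⁻¹) * (v * w)⁻¹ := by group
      _ = _ := by rw [hct']
  refine ⟨hconj, congrArg _ ?_⟩
  have hmem : ∀ s ∈ S', ∀ t ∈ S, s * t * s⁻¹ ∈ S := by
    intro s hs t ht
    obtain ⟨u, hu, hut⟩ := hinner s hs
    rw [hut t ht]
    exact mul_mem (mul_mem hu ht) (inv_mem hu)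
  have hmem_iff : ∀ s ∈ S', ∀ t, s * t * s⁻¹ ∈ S ↔ t ∈ S := by
    refine fun s hs t => ⟨fun h => ?_, hmem s hs t⟩
    simpa [mul_assoc] using hmem s⁻¹ (inv_mem hs) _ h
  let X : Finset G := Finset.univ.filter fun x => ∃ h ∈ H, x = d * h
  let f : G → ℂ := fun x => if x ^ m ∈ S then η (x ^ m) else 0
  have hf : ∀ s ∈ S', ∀ x ∈ X, f (s * x * s⁻¹) = f x := by
    intro s hs x _
    simp only [f, conj_pow, hmem_iff s hs]
    split_ifs with hx
    · obtain ⟨u, hu, hut⟩ := hinner s hs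
      rw [hut _ hx, hη u hu _ hx]
    · rfl
  have hsum := S'.sum_eq_sum_conj_representatives X R'
    (fun s hs x hx => by simpa [X] using hconj s hs x (by simpa [X] using hx))
    (fun r hr => by simpa [X] using hR'sub r hr)
    (fun x hx => hR'rep x (by simpa [X] using hx)) f hf
  have hX : X = (Finset.univ.filter (· ∈ H)).image (d * ·) := by
    ext x
    simp only [X, Finset.mem_filter_univ, Finset.mem_image]
    exact exists_congr fun h => and_congr_right fun _ => eq_comm
  rw [hX, Finset.sum_image (fun _ _ _ _ h => mul_left_cancel h)] at hsum
  simp only [f, mul_ite, mul_zero] at hsum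
  rwa [← Finset.sum_filter, ← Finset.sum_filter, Finset.filter_filter] at hsum
end
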